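/- arXiv:2408.02328 — 2 statements merged into one kernel-verified Lean document; each statement's English description precedes it below -/
import Mathlib

section
/- For every prime p ≥ 3 there exists a constant c_p > 0 such that for all n ≥ 1, any subset S ⊆ 𝔽_p^n containing no three-term arithmetic progression satisfies |S| ≤ c_p · p^n / n. -/
namespace Meshulam

open Finset Module

/-- A finite set containing no nontrivial three-term arithmetic progression. -/
def APFree {V : Type*} [AddCommGroup V] (S : Finset V) : Prop :=
  ∀ x ∈ S, ∀ y ∈ S, ∀ z ∈ S, x + z = y + y → x = y ∧ y = z

variable {p : ℕ} [Fact p.Prime] {V : Type} [AddCommGroup V] [Module (ZMod p) V]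

/-- The exponential sum of `S` at the linear functional `f`. -/
noncomputable def expSum (S : Finset V) (f : Dual (ZMod p) V) : ℂ :=
  ∑ x ∈ S, ZMod.stdAddChar (f x)

lemma norm_stdAddChar (t : ZMod p) : ‖ZMod.stdAddChar t‖ = 1 :=
  AddChar.norm_apply _ _

lemma expSum_zero (S : Finset V) : expSum S (0 : Dual (ZMod p) V) = #S := by
  simp [expSum]

lemma sum_stdAddChar_eq_zero : ∑ t : ZMod p, (ZMod.stdAddChar t : ℂ) = 0 := by
  have hp : Nontrivial (ZMod p) := inferInstance
  refine AddChar.sum_eq_zero_of_ne_one ?_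
  intro h
  have h1 : (ZMod.stdAddChar (1 : ZMod p) : ℂ) = ZMod.stdAddChar (0 : ZMod p) := by simp [h]
  exact one_ne_zero (ZMod.injective_stdAddChar h1)

/-- If every fibre of `f` on `S` has at most `B` points, then the exponential sum is small. -/
lemma norm_expSum_le (S : Finset V) (f : Dual (ZMod p) V) (B : ℝ)
    (hB : ∀ t, (#{x ∈ S | f x = t} : ℝ) ≤ B) : ‖expSum S f‖ ≤ p * B - #S := by
  have hcard : ∑ t : ZMod p, (#{x ∈ S | f x = t} : ℝ) = #S := by
    exact_mod_cast (card_eq_sum_card_fiberwise (f := f) (s := S) (t := univ)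
      (fun _ _ => by simp)).symm
  have hfib : expSum S f = ∑ t : ZMod p, ZMod.stdAddChar t * (#{x ∈ S | f x = t} : ℂ) := by
    rw [expSum, ← sum_fiberwise S f]
    refine sum_congr rfl fun t _ => ?_
    rw [sum_congr rfl (g := fun _ => (ZMod.stdAddChar t : ℂ))]
    · simp [mul_comm]
    · intro x hx
      rw [(mem_filter.1 hx).2]
  have hshift : expSum S f =
      ∑ t : ZMod p, ZMod.stdAddChar t * (((#{x ∈ S | f x = t} : ℝ) - B : ℝ) : ℂ) := by
    push_cast
    simp_rw [mul_sub, sum_sub_distrib, ← sum_mul, sum_stdAddChar_eq_zero, hfib]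
    simp
  calc ‖expSum S f‖
      ≤ ∑ t : ZMod p, (B - #{x ∈ S | f x = t}) := by
        rw [hshift]
        refine norm_sum_le_of_le _ fun t _ => ?_
        rw [norm_mul, norm_stdAddChar, one_mul, Complex.norm_real, Real.norm_eq_abs,
          abs_of_nonpos (sub_nonpos.2 (hB t)), neg_sub]
    _ = p * B - #S := by
        rw [sum_sub_distrib, hcard]
        simp

section Orthogonality

variable [Finite V]

noncomputable instance : Fintype (Dual (ZMod p) V) :=
  have : Finite (Dual (ZMod p) V) := DFunLike.finite _
  Fintype.ofFinite _

lemma card_dual : Fintype.card (Dual (ZMod p) V) = Nat.card V := by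
  have : Module.Finite (ZMod p) V := Module.Finite.of_finite
  rw [← Nat.card_eq_fintype_card, Module.natCard_eq_pow_finrank (K := ZMod p),
    Module.natCard_eq_pow_finrank (K := ZMod p) (V := V), Subspace.dual_finrank_eq]

lemma sum_dual_stdAddChar [DecidableEq V] (x : V) :
    ∑ f : Dual (ZMod p) V, (ZMod.stdAddChar (f x) : ℂ) = if x = 0 then (Nat.card V : ℂ) else 0 := by
  split_ifs with hx
  · simp [hx, card_dual]
  · obtain ⟨f, hf⟩ := not_forall.1 (mt (Module.forall_dual_apply_eq_zero_iff (ZMod p) x).1 hx)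
    let χ : AddChar (Dual (ZMod p) V) ℂ :=
      ZMod.stdAddChar.compAddMonoidHom (Dual.eval (ZMod p) V x).toAddMonoidHom
    refine AddChar.sum_eq_zero_of_ne_one (ψ := χ) fun h => hf ?_
    have h1 : χ f = 1 := by simp [h]
    refine ZMod.injective_stdAddChar (N := p) ?_
    rw [AddChar.map_zero_eq_one]
    exact h1

lemma sum_norm_expSum_sq (S : Finset V) :
    ∑ f : Dual (ZMod p) V, ‖expSum S f‖ ^ 2 = Nat.card V * #S := by
  classical
  have key : ∑ f : Dual (ZMod p) V, expSum S f * (starRingEnd ℂ) (expSum S f) =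
      Nat.card V * #S := by
    have hexp (f : Dual (ZMod p) V) : expSum S f * (starRingEnd ℂ) (expSum S f) =
        ∑ x ∈ S, ∑ y ∈ S, ZMod.stdAddChar (f (x - y)) := by
      simp only [expSum, map_sum, sum_mul_sum]
      refine sum_congr rfl fun x _ => sum_congr rfl fun y _ => ?_
      rw [← AddChar.map_neg_eq_conj, ← AddChar.map_add_eq_mul, map_sub, sub_eq_add_neg]
    simp_rw [hexp]
    rw [sum_comm]
    simp_rw [sum_comm (s := univ), sum_dual_stdAddChar, sub_eq_zero]
    simp [mul_comm]
  have : ((∑ f : Dual (ZMod p) V, ‖expSum S f‖ ^ 2 : ℝ) : ℂ) = (Nat.card V * #S : ℝ) := by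
    push_cast
    rw [← key]
    exact sum_congr rfl fun f _ => (Complex.mul_conj' _).symm
  exact_mod_cast this

lemma sum_expSum_of_apFree {S : Finset V} (hS : APFree S) :
    ∑ f : Dual (ZMod p) V, expSum S f ^ 2 * expSum S (-(f + f)) = Nat.card V * #S := by
  classical
  have hexp (f : Dual (ZMod p) V) : expSum S f ^ 2 * expSum S (-(f + f)) =
      ∑ x ∈ S, ∑ z ∈ S, ∑ y ∈ S, ZMod.stdAddChar (f (x + z - (y + y))) := by
    rw [expSum, sq, sum_mul_sum, sum_mul]
    simp_rw [expSum, sum_mul, mul_sum]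
    refine sum_congr rfl fun x _ => sum_congr rfl fun z _ => sum_congr rfl fun y _ => ?_
    rw [← AddChar.map_add_eq_mul, ← AddChar.map_add_eq_mul]
    simp [sub_eq_add_neg]
  simp_rw [hexp]
  simp_rw [sum_comm (s := univ), sum_dual_stdAddChar, sub_eq_zero]
  have hx : ∀ x ∈ S, ∑ z ∈ S, ∑ y ∈ S, (if x + z = y + y then (Nat.card V : ℂ) else 0) =
      Nat.card V := by
    intro x hx
    rw [sum_eq_single_of_mem x hx, sum_eq_single_of_mem x hx]
    · simp
    · intro y hy hne
      exact if_neg fun h => hne (hS x hx y hy x hx h).1.symm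
    · intro z hz hne
      refine sum_eq_zero fun y hy => if_neg fun h => hne ?_
      obtain ⟨h1, h2⟩ := hS x hx y hy z hz h
      exact (h1.trans h2).symm
  rw [sum_congr rfl hx]
  simp [mul_comm]

/-- The inequality relating the size of a progression-free set to that of its slices. -/
lemma card_sq_le [Nontrivial V] (hp3 : 3 ≤ p) {S : Finset V} (hS : APFree S) (B : ℝ)
    (hB : ∀ f : Dual (ZMod p) V, f ≠ 0 → ∀ t, (#{x ∈ S | f x = t} : ℝ) ≤ B) :
    (#S : ℝ) ^ 2 ≤ Nat.card V * (1 + (p * B - #S)) := by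
  classical
  obtain ⟨f₀, hf₀⟩ := exists_ne (0 : Dual (ZMod p) V)
  have hM : 0 ≤ p * B - #S := (norm_nonneg _).trans (norm_expSum_le S f₀ B (hB f₀ hf₀))
  rcases S.eq_empty_or_nonempty with rfl | hne
  · simp only [card_empty, Nat.cast_zero, sub_zero] at hM ⊢
    rw [zero_pow two_ne_zero]
    positivity
  have hpos : (0 : ℝ) < #S := by exact_mod_cast hne.card_pos
  have htwo (f : Dual (ZMod p) V) (hf : f ≠ 0) : -(f + f) ≠ 0 := by
    have h2 : (2 : ZMod p) ≠ 0 := by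
      intro h
      have : p ∣ 2 := (ZMod.natCast_eq_zero_iff 2 p).1 (by exact_mod_cast h)
      exact absurd (Nat.le_of_dvd two_pos this) (by omega)
    rw [neg_ne_zero, ← two_smul (ZMod p) f]
    exact smul_ne_zero h2 hf
  have hsum := sum_expSum_of_apFree (p := p) hS
  rw [← add_sum_erase _ _ (mem_univ 0)] at hsum
  simp only [add_zero, neg_zero, expSum_zero] at hsum
  have hrest : ‖∑ f ∈ univ.erase (0 : Dual (ZMod p) V), expSum S f ^ 2 * expSum S (-(f + f))‖ ≤
      (Nat.card V * #S) * (p * B - #S) := by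
    rw [← sum_norm_expSum_sq (p := p), sum_mul]
    refine (norm_sum_le_of_le _ fun f hf => ?_).trans
      (sum_le_sum_of_subset_of_nonneg (erase_subset 0 univ) fun f _ _ => by positivity)
    rw [norm_mul, norm_pow]
    gcongr
    exact norm_expSum_le S _ B (hB _ (htwo f (ne_of_mem_erase hf)))
  have hcube : (#S : ℝ) ^ 3 ≤ Nat.card V * #S + (Nat.card V * #S) * (p * B - #S) := by
    have heq : ((#S : ℂ)) ^ 3 = Nat.card V * #S -
        ∑ f ∈ univ.erase (0 : Dual (ZMod p) V), expSum S f ^ 2 * expSum S (-(f + f)) := by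
      rw [← hsum]
      ring
    calc (#S : ℝ) ^ 3 = ‖(#S : ℂ) ^ 3‖ := by simp
      _ ≤ ‖(Nat.card V * #S : ℂ)‖ + _ := heq ▸ norm_sub_le _ _
      _ ≤ _ := by
        gcongr
        simp
  refine le_of_mul_le_mul_right ?_ hpos
  linarith

end Orthogonality

/-- A bound for progression-free subsets of a hyperplane applies to its translates. -/
lemma card_slice_le {S : Finset V} (hS : APFree S) (f : Dual (ZMod p) V) {B : ℝ} (hB0 : 0 ≤ B)
    (hB : ∀ T : Finset (LinearMap.ker f), APFree T → (#T : ℝ) ≤ B) (t : ZMod p) :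
    (#{x ∈ S | f x = t} : ℝ) ≤ B := by
  classical
  rcases ({x ∈ S | f x = t}).eq_empty_or_nonempty with h | ⟨v, hv⟩
  · simpa [h] using hB0
  have hinj : Function.Injective fun w : LinearMap.ker f => v + (w : V) :=
    (add_right_injective v).comp Subtype.val_injective
  let T : Finset (LinearMap.ker f) := S.preimage (fun w => v + (w : V)) hinj.injOn
  have hT : APFree T := by
    intro x hx y hy z hz h
    have h' : (x : V) + z = y + y := by exact_mod_cast congrArg Subtype.val h
    obtain ⟨h1, h2⟩ := hS _ (mem_preimage.1 hx) _ (mem_preimage.1 hy) _ (mem_preimage.1 hz)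
      (by rw [add_add_add_comm, h', add_add_add_comm])
    exact ⟨hinj h1, hinj h2⟩
  have hle : #{x ∈ S | f x = t} ≤ #T := by
    rw [← card_image_of_injective T hinj]
    refine card_le_card fun x hx => ?_
    rw [mem_filter] at hx hv
    refine mem_image.2 ⟨⟨x - v, ?_⟩, ?_, ?_⟩
    · simp [hx.2, hv.2]
    · simpa [T] using hx.1
    · simp
  exact (Nat.cast_le.2 hle).trans (hB T hT)

lemma sq_le_three_pow (n : ℕ) : n ^ 2 ≤ 3 ^ n := by
  induction n with
  | zero => simp
  | succ k ih =>
    rcases Nat.lt_or_ge k 2 with hk | hk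
    · interval_cases k <;> norm_num
    · rw [pow_succ 3]
      nlinarith

/-- The numerical step of the induction. -/
lemma le_of_sq_le {s N n : ℝ} (hn : 1 ≤ n) (hN : (n + 1) ^ 2 ≤ N)
    (h : s ^ 2 ≤ N * (1 + (3 * N / n - s))) : s ≤ 3 * N / (n + 1) := by
  by_contra! hlt
  have hNpos : 0 < N := lt_of_lt_of_le (by positivity) hN
  have h1 : (3 * N / (n + 1)) ^ 2 + N * (3 * N / (n + 1)) < s ^ 2 + N * s := by
    gcongr
  have h2 : (3 * N / (n + 1)) ^ 2 + N * (3 * N / (n + 1)) < N + N * (3 * N / n) := by linarith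
  have h3 : 3 * N / n ≤ 3 * N / (n + 1) + 6 * N / (n + 1) ^ 2 := by
    rw [div_add_div _ _ (by positivity) (by positivity), div_le_div_iff₀ (by positivity)
      (by positivity)]
    have : 0 ≤ N * (n + 1) * (3 * (n - 1)) :=
      mul_nonneg (by positivity) (by linarith)
    nlinarith [this]
  have h4 : N ≤ N ^ 2 / (n + 1) ^ 2 := by
    rw [le_div_iff₀ (by positivity)]
    nlinarith
  have h5 : N * (3 * N / n) ≤ N * (3 * N / (n + 1) + 6 * N / (n + 1) ^ 2) := by gcongr
  have h6 : 0 < N ^ 2 / (n + 1) ^ 2 := by positivity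
  have h7 : (3 * N / (n + 1)) ^ 2 = 9 * (N ^ 2 / (n + 1) ^ 2) := by
    rw [div_pow, mul_pow]
    ring
  have h8 : N * (6 * N / (n + 1) ^ 2) = 6 * (N ^ 2 / (n + 1) ^ 2) := by ring
  linarith

theorem card_le_of_apFree (hp3 : 3 ≤ p) (n : ℕ) (hn : 1 ≤ n) :
    ∀ (V : Type) [AddCommGroup V] [Module (ZMod p) V] [Finite V], finrank (ZMod p) V = n →
      ∀ S : Finset V, APFree S → (#S : ℝ) ≤ 3 * (p : ℝ) ^ n / n := by
  have hp0 : (0 : ℝ) < p := by exact_mod_cast (by omega : 0 < p)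
  induction n, hn using Nat.le_induction with
  | base =>
    intro V _ _ _ hV S _
    have : Fintype V := Fintype.ofFinite V
    have hle : (#S : ℝ) ≤ p := by
      have h := card_le_univ S
      rw [← Nat.card_eq_fintype_card, Module.natCard_eq_pow_finrank (K := ZMod p), hV] at h
      exact_mod_cast (by simpa using h : #S ≤ p)
    norm_num
    linarith
  | succ n hn ih =>
    intro V _ _ _ hV S hS
    have hcard : (Nat.card V : ℝ) = (p : ℝ) ^ (n + 1) := by
      rw [Module.natCard_eq_pow_finrank (K := ZMod p), hV]
      simp
    have hn1 : (1 : ℝ) ≤ n := by exact_mod_cast hn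
    have : Module.Finite (ZMod p) V := Module.Finite.of_finite
    have : Nontrivial V := Module.nontrivial_of_finrank_pos (R := ZMod p) (by omega)
    have hsq := card_sq_le hp3 hS (3 * (p : ℝ) ^ n / n) fun f hf =>
      card_slice_le hS f (by positivity) <| ih (LinearMap.ker f) <| by
        have := Module.Dual.finrank_ker_add_one_of_ne_zero hf
        omega
    rw [hcard, show p * (3 * (p : ℝ) ^ n / n) = 3 * (p : ℝ) ^ (n + 1) / n by ring] at hsq
    rw [Nat.cast_add, Nat.cast_one]
    refine le_of_sq_le hn1 ?_ hsq
    exact_mod_cast (sq_le_three_pow (n + 1)).trans (Nat.pow_le_pow_left hp3 (n + 1))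

end Meshulam

/-- Meshulam's theorem: for every prime `p ≥ 3`, progression-free subsets of `𝔽_p^n`
have size at most `c_p · p^n / n`. -/
theorem meshulam (p : ℕ) (hp : p.Prime) (hp3 : 3 ≤ p) :
    ∃ c : ℝ, 0 < c ∧
      ∀ n : ℕ, 1 ≤ n →
        ∀ S : Finset (Fin n → ZMod p),
          (∀ x ∈ S, ∀ y ∈ S, ∀ z ∈ S, x + z = y + y → x = y ∧ y = z) →
          (S.card : ℝ) ≤ c * (p : ℝ) ^ n / n := by
  have : Fact p.Prime := ⟨hp⟩
  exact ⟨3, three_pos, fun n hn S hS =>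
    Meshulam.card_le_of_apFree hp3 n hn (Fin n → ZMod p) (by simp) S hS⟩
end

section
/- Let G be a finite additive abelian group such that the subgroup 2G = {2g : g ∈ G} is nontrivial, and let S ⊆ G be a set containing no three-term arithmetic progression. Then |S| < 2·|G| / rank(2G), where rank(2G) is the number r of cyclic factors in the invariant factor decomposition 2G ≅ ℤ/d_1ℤ ⊕ ⋯ ⊕ ℤ/d_rℤ with d_1 | d_2 | ⋯ | d_r (equivalently, the minimal number of generators of 2G). -/
open Finset in
/-- Parseval's identity for the indicator function of the injective image of `S` under `f`. -/
theorem AddChar.sum_norm_sq_sum_apply {ι G : Type*} [AddCommGroup G] [Fintype G] (S : Finset ι)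
    (f : ι → G) (hf : Set.InjOn f S) :
    ∑ χ : AddChar G ℂ, ‖∑ s ∈ S, χ (f s)‖ ^ 2 = (Fintype.card G : ℝ) * #S := by
  classical
  have expand (χ : AddChar G ℂ) :
      ((‖∑ s ∈ S, χ (f s)‖ ^ 2 : ℝ) : ℂ) = ∑ s ∈ S, ∑ t ∈ S, χ (f s - f t) := by
    push_cast
    rw [← Complex.mul_conj', map_sum, sum_mul_sum]
    simp only [sub_eq_add_neg, AddChar.map_add_eq_mul, AddChar.map_neg_eq_conj]
  apply Complex.ofReal_injective
  rw [Complex.ofReal_sum, sum_congr rfl fun χ _ => expand χ, sum_comm]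
  have inner (s) (hs : s ∈ S) :
      ∑ χ : AddChar G ℂ, ∑ t ∈ S, χ (f s - f t) = (Fintype.card G : ℂ) := by
    rw [sum_comm]
    simp only [AddChar.sum_apply_eq_ite, sub_eq_zero]
    rw [sum_eq_single_of_mem s hs fun t ht hts => if_neg fun h => hts (hf hs ht h).symm]
    simp
  rw [sum_congr rfl inner]
  simp [mul_comm]

open Finset in
theorem ThreeAPFree.sum_addChar_eq {G : Type*} [AddCommGroup G] [Fintype G] {S : Finset G}
    (hS : ThreeAPFree (S : Set G)) :
    ∑ χ : AddChar G ℂ, (∑ s ∈ S, χ s) ^ 2 * ∑ s ∈ S, χ (-(s + s)) =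
      (Fintype.card G : ℂ) * #S := by
  classical
  have expand (χ : AddChar G ℂ) : (∑ s ∈ S, χ s) ^ 2 * ∑ s ∈ S, χ (-(s + s)) =
      ∑ x ∈ S, ∑ z ∈ S, ∑ y ∈ S, χ (x + z - (y + y)) := by
    rw [pow_two, sum_mul_sum, sum_mul]
    refine sum_congr rfl fun x _ => ?_
    rw [sum_mul]
    refine sum_congr rfl fun z _ => ?_
    rw [mul_sum]
    refine sum_congr rfl fun y _ => ?_
    rw [sub_eq_add_neg, AddChar.map_add_eq_mul χ (x + z), AddChar.map_add_eq_mul χ x]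
  rw [sum_congr rfl fun χ _ => expand χ, sum_comm]
  have inner (x) (hx : x ∈ S) :
      ∑ χ : AddChar G ℂ, ∑ z ∈ S, ∑ y ∈ S, χ (x + z - (y + y)) = (Fintype.card G : ℂ) := by
    rw [sum_comm]
    rw [sum_eq_single_of_mem x hx]
    · rw [sum_comm]
      simp only [AddChar.sum_apply_eq_ite, sub_eq_zero]
      rw [sum_eq_single_of_mem x hx fun y hy hyx => if_neg fun h => hyx (hS hx hy hx h).symm]
      simp
    · intro z hz hzx
      rw [sum_comm]
      simp only [AddChar.sum_apply_eq_ite, sub_eq_zero]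
      refine sum_eq_zero fun y hy => if_neg fun h => hzx ?_
      have hxy := hS hx hy hz h
      subst hxy
      exact add_left_cancel h
  rw [sum_congr rfl inner]
  simp [mul_comm]

/-- The kernel of an additive character. -/
def AddChar.ker {G : Type*} [AddCommGroup G] (χ : AddChar G ℂ) : AddSubgroup G :=
  χ.toAddMonoidHom.ker

theorem AddChar.mem_ker {G : Type*} [AddCommGroup G] {χ : AddChar G ℂ} {g : G} :
    g ∈ χ.ker ↔ χ g = 1 := Iff.rfl

theorem AddChar.exists_forall_eq_zpow {G : Type*} [AddCommGroup G] [Finite G]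
    (χ : AddChar G ℂ) : ∃ a, ∀ g, ∃ n : ℤ, χ g = χ a ^ n := by
  have : Finite χ.toMonoidHom.toHomUnits.range :=
    Finite.of_surjective _ χ.toMonoidHom.toHomUnits.rangeRestrict_surjective
  obtain ⟨⟨_, a, rfl⟩, ha⟩ := IsCyclic.exists_generator (α := χ.toMonoidHom.toHomUnits.range)
  refine ⟨a.toAdd, fun g => ?_⟩
  obtain ⟨n, hn⟩ := ha ⟨_, Multiplicative.ofAdd g, rfl⟩
  refine ⟨n, ?_⟩
  have := congrArg (fun u : χ.toMonoidHom.toHomUnits.range => ((u : ℂˣ) : ℂ)) hn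
  simpa using this.symm

/-- The subgroup `2G` cannot be generated by fewer than `r` elements. -/
def DoublingRankGE (G : Type*) [AddCommGroup G] (r : ℕ) : Prop :=
  ∀ T : Finset G,
    (∀ g : G, g + g ∈ AddSubgroup.closure ((fun t : G => t + t) '' T)) → r ≤ T.card

theorem DoublingRankGE.ker {G : Type*} [AddCommGroup G] [Finite G] {r : ℕ}
    (h : DoublingRankGE G (r + 1)) (χ : AddChar G ℂ) : DoublingRankGE χ.ker r := by
  classical
  intro T hT
  obtain ⟨a, ha⟩ := χ.exists_forall_eq_zpow
  suffices hgen : ∀ g : G, g + g ∈ AddSubgroup.closure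
      ((fun t : G => t + t) '' (insert a (T.image (↑)) : Finset G)) by
    have h₁ := h _ hgen
    have h₂ := Finset.card_insert_le a (T.image ((↑) : χ.ker → G))
    have h₃ := Finset.card_image_le (s := T) (f := ((↑) : χ.ker → G))
    omega
  intro g
  obtain ⟨n, hn⟩ := ha g
  have hk : g - n • a ∈ χ.ker := by
    rw [AddChar.mem_ker, AddChar.map_sub_eq_div, AddChar.map_zsmul_eq_zpow, hn]
    exact div_self (zpow_ne_zero _ (χ.val_isUnit a).ne_zero)
  have hdouble : g + g = n • (a + a) + ((g - n • a) + (g - n • a)) := by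
    rw [smul_add]; abel
  rw [hdouble]
  refine add_mem (AddSubgroup.zsmul_mem _ (AddSubgroup.subset_closure ?_) n) ?_
  · exact ⟨a, by simp, rfl⟩
  have hmap := AddSubgroup.mem_map_of_mem χ.ker.subtype (hT ⟨g - n • a, hk⟩)
  rw [AddMonoidHom.map_closure] at hmap
  refine AddSubgroup.closure_mono ?_ hmap
  rintro _ ⟨_, ⟨t, ht, rfl⟩, rfl⟩
  exact ⟨(t : G), Finset.mem_coe.2 (Finset.mem_insert_of_mem (Finset.mem_image_of_mem _ ht)), rfl⟩

theorem DoublingRankGE.exists_add_self_ne_zero {G : Type*} [AddCommGroup G] {r : ℕ}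
    (h : DoublingRankGE G (r + 1)) : ∃ g : G, g + g ≠ 0 := by
  by_contra! hzero
  simpa using h ∅ (by simp [hzero])

theorem DoublingRankGE.two_pow_le_card {G : Type*} [AddCommGroup G] [Finite G] {r : ℕ}
    (h : DoublingRankGE G r) : 2 ^ r ≤ Nat.card G := by
  induction r generalizing G with
  | zero => simpa using Nat.one_le_iff_ne_zero.2 Nat.card_pos.ne'
  | succ r ih =>
    obtain ⟨g, hg⟩ := h.exists_add_self_ne_zero
    obtain ⟨χ, hχ⟩ := AddChar.exists_apply_ne_zero.2 hg
    have hker : χ.ker ≠ ⊤ := fun htop => hχ (AddChar.mem_ker.1 (htop ▸ AddSubgroup.mem_top _))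
    rw [← χ.ker.card_mul_index, pow_succ]
    exact Nat.mul_le_mul (ih (h.ker χ)) (AddSubgroup.one_lt_index_of_ne_top hker)

open Finset in
/-- If every translate of `S` has at most `c` points in the kernel `K` of a nontrivial
character `χ`, then the corresponding Fourier coefficient of `S` is at most `c|G|/|K| - |S|`. -/
theorem AddChar.card_ker_mul_norm_sum_le {G : Type*} [AddCommGroup G] [Fintype G] [DecidableEq G]
    (S : Finset G) (χ : AddChar G ℂ) [Fintype χ.ker] (hχ : χ ≠ 0) (c : ℝ)
    (hc : ∀ g : G, (#{k : χ.ker | g + k ∈ S} : ℝ) ≤ c) :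
    Nat.card χ.ker * ‖∑ s ∈ S, χ s‖ ≤ c * Fintype.card G - Nat.card χ.ker * #S := by
  have count {M : Type} [AddCommMonoid M] (F : G → M) (hF : ∀ g, ∀ k : χ.ker, F (g + k) = F g) :
      ∑ g : G, #{k : χ.ker | g + k ∈ S} • F g = Nat.card χ.ker • ∑ s ∈ S, F s := by
    have (g : G) : #{k : χ.ker | g + k ∈ S} • F g =
        ∑ k : χ.ker, if g + k ∈ S then F (g + k) else 0 := by
      simp [hF, ← sum_filter]
    simp_rw [this]
    rw [sum_comm]
    have (k : χ.ker) : ∑ g : G, (if g + k ∈ S then F (g + k) else 0) = ∑ s ∈ S, F s := by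
      exact (Equiv.sum_comp (Equiv.addRight (k : G)) fun g => if g ∈ S then F g else 0).trans
        (by simp)
    simp [this]
  have hsum := count χ fun g k => by
    rw [AddChar.map_add_eq_mul, AddChar.mem_ker.1 k.2, mul_one]
  have hcard := count (fun _ => (1 : ℝ)) fun _ _ => rfl
  have hdiff : (Nat.card χ.ker : ℂ) * ∑ s ∈ S, χ s =
      ∑ g : G, ((#{k : χ.ker | g + k ∈ S} : ℂ) - (c : ℂ)) * χ g := by
    simp only [sub_mul, sum_sub_distrib, ← mul_sum]
    rw [AddChar.sum_eq_zero_iff_ne_zero.2 hχ, mul_zero, sub_zero]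
    simpa using hsum.symm
  calc (Nat.card χ.ker : ℝ) * ‖∑ s ∈ S, χ s‖
      = ‖∑ g : G, ((#{k : χ.ker | g + k ∈ S} : ℂ) - (c : ℂ)) * χ g‖ := by
        rw [← hdiff, norm_mul, Complex.norm_natCast]
    _ ≤ ∑ g : G, ‖((#{k : χ.ker | g + k ∈ S} : ℂ) - (c : ℂ)) * χ g‖ := norm_sum_le _ _
    _ = ∑ g : G, (c - #{k : χ.ker | g + k ∈ S}) := by
        refine sum_congr rfl fun g _ => ?_
        rw [norm_mul, AddChar.norm_apply, mul_one, ← Complex.ofReal_natCast,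
          ← Complex.ofReal_sub, Complex.norm_real, Real.norm_eq_abs, abs_sub_comm,
          abs_of_nonneg (sub_nonneg.2 (hc g))]
    _ = c * Fintype.card G - Nat.card χ.ker * #S := by
        have : ∑ g : G, (#{k : χ.ker | g + k ∈ S} : ℝ) = Nat.card χ.ker * #S := by simpa using hcard
        rw [sum_sub_distrib, this]
        simp [mul_comm]

open Finset in
/-- A uniform bound `M` on the Fourier coefficients at characters that do not vanish on `2G`
yields the main density inequality. -/
theorem ThreeAPFree.card_sq_le {G : Type*} [AddCommGroup G] [Fintype G] {S : Finset G}
    (hS : ThreeAPFree (S : Set G)) (M : ℝ) (hM₀ : 0 ≤ M)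
    (hM : ∀ χ : AddChar G ℂ, (∃ g, χ (g + g) ≠ 1) → ‖∑ s ∈ S, χ s‖ ≤ M) :
    (#S : ℝ) ^ 3 ≤ Fintype.card G * #S + M * (Fintype.card G * #S - (#S : ℝ) ^ 2) := by
  classical
  set n : ℝ := (Fintype.card G : ℝ)
  set p : ℝ := (#S : ℝ) with hp
  let F (χ : AddChar G ℂ) : ℂ := ∑ s ∈ S, χ s
  let E (χ : AddChar G ℂ) : ℂ := ∑ s ∈ S, χ (-(s + s))
  let A : Finset (AddChar G ℂ) := univ.filter fun χ => ∀ g, χ (g + g) = 1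
  have hinj : Set.InjOn (fun s : G => -(s + s)) S := fun x hx y hy h =>
    hS hx hy hx (neg_injective h)
  have hF : ∑ χ, ‖F χ‖ ^ 2 = n * p := AddChar.sum_norm_sq_sum_apply S id Function.injective_id.injOn
  have hE : ∑ χ, ‖E χ‖ ^ 2 = n * p := AddChar.sum_norm_sq_sum_apply S _ hinj
  have hEA (χ) (hχ : χ ∈ A) : E χ = (p : ℂ) := by
    have hχ' := (mem_filter.1 hχ).2
    simp [E, hχ', hp]
  have hFA (χ) (hχ : χ ∈ A) : F χ ^ 2 = ((‖F χ‖ ^ 2 : ℝ) : ℂ) := by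
    have hχ' := (mem_filter.1 hχ).2
    have hconj : (starRingEnd ℂ) (F χ) = F χ := by
      simp only [F, map_sum]
      refine sum_congr rfl fun s _ => ?_
      rw [← AddChar.map_neg_eq_conj, AddChar.map_neg_eq_inv]
      exact inv_eq_of_mul_eq_one_right (by rw [← AddChar.map_add_eq_mul, hχ'])
    push_cast
    rw [← Complex.mul_conj', hconj, sq]
  have hA : (0 : AddChar G ℂ) ∈ A := by simp [A]
  have hF0 : ‖F 0‖ = p := by simp [F, hp]
  have hE0 : ‖E 0‖ = p := by simp [E, hp]
  have hFA_ge : p ^ 2 ≤ ∑ χ ∈ A, ‖F χ‖ ^ 2 := by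
    rw [← hF0]
    exact single_le_sum (f := fun χ => ‖F χ‖ ^ 2) (fun _ _ => by positivity) hA
  have hEA_ge : p ^ 2 ≤ ∑ χ ∈ A, ‖E χ‖ ^ 2 := by
    rw [← hE0]
    exact single_le_sum (f := fun χ => ‖E χ‖ ^ 2) (fun _ _ => by positivity) hA
  have hFsplit := sum_add_sum_compl A fun χ => ‖F χ‖ ^ 2
  have hEsplit := sum_add_sum_compl A fun χ => ‖E χ‖ ^ 2
  have hcount : ∑ χ, (F χ ^ 2 * E χ).re = n * p := by
    rw [← Complex.re_sum, hS.sum_addChar_eq]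
    simp [n, hp]
  have hsplit := sum_add_sum_compl A fun χ => (F χ ^ 2 * E χ).re
  have hmain : ∑ χ ∈ A, (F χ ^ 2 * E χ).re = p * ∑ χ ∈ A, ‖F χ‖ ^ 2 := by
    rw [mul_sum]
    refine sum_congr rfl fun χ hχ => ?_
    rw [hFA χ hχ, hEA χ hχ, ← Complex.ofReal_mul, Complex.ofReal_re, mul_comm]
  have herr : -(M * (n * p - p ^ 2)) ≤ ∑ χ ∈ Aᶜ, (F χ ^ 2 * E χ).re := by
    have hterm (χ) (hχ : χ ∈ Aᶜ) :
        -(M * ((‖F χ‖ ^ 2 + ‖E χ‖ ^ 2) / 2)) ≤ (F χ ^ 2 * E χ).re := by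
      have hFM : ‖F χ‖ ≤ M := hM χ (by simpa [A] using hχ)
      have hre := (abs_le.1 (Complex.abs_re_le_norm (F χ ^ 2 * E χ))).1
      have hnorm : ‖F χ ^ 2 * E χ‖ ≤ M * ((‖F χ‖ ^ 2 + ‖E χ‖ ^ 2) / 2) :=
        calc ‖F χ ^ 2 * E χ‖ = ‖F χ‖ * (‖F χ‖ * ‖E χ‖) := by rw [norm_mul, norm_pow]; ring
          _ ≤ M * (‖F χ‖ * ‖E χ‖) := by gcongr
          _ ≤ _ := by
            gcongr
            nlinarith [sq_nonneg (‖F χ‖ - ‖E χ‖)]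
      linarith
    have hsum := sum_le_sum hterm
    rw [sum_neg_distrib, ← mul_sum, ← sum_div, sum_add_distrib] at hsum
    refine le_trans (neg_le_neg (mul_le_mul_of_nonneg_left ?_ hM₀)) hsum
    linarith
  have hp₀ : 0 ≤ p := Nat.cast_nonneg _
  nlinarith [mul_le_mul_of_nonneg_left hFA_ge hp₀]

open Finset in
theorem ThreeAPFree.mul_card_lt {G : Type*} [AddCommGroup G] [Fintype G] {S : Finset G}
    (hS : ThreeAPFree (S : Set G)) {r : ℕ} (hr : DoublingRankGE G r) :
    (r : ℝ) * #S < 2 * Fintype.card G := by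
  classical
  have hn : (0 : ℝ) < Fintype.card G := Nat.cast_pos.2 Fintype.card_pos
  have hSn : (#S : ℝ) ≤ Fintype.card G := Nat.cast_le.2 (card_le_univ S)
  induction r generalizing G with
  | zero => simpa using hn
  | succ q ih =>
    rcases Nat.eq_zero_or_pos q with rfl | hq
    · simp only [zero_add, Nat.cast_one, one_mul]
      linarith
    have hq' : (0 : ℝ) < q := Nat.cast_pos.2 hq
    have hbound (χ : AddChar G ℂ) (hχ : ∃ g, χ (g + g) ≠ 1) :
        ‖∑ s ∈ S, χ s‖ ≤ 2 * Fintype.card G / q - #S := by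
      have hK : (0 : ℝ) < Nat.card χ.ker := Nat.cast_pos.2 Nat.card_pos
      have hcoset (g : G) : (#{k : χ.ker | g + k ∈ S} : ℝ) ≤ 2 * Nat.card χ.ker / q := by
        have hfree : ThreeAPFree (((univ.filter fun k : χ.ker => g + k ∈ S) : Finset χ.ker) :
            Set χ.ker) := by
          intro x hx y hy z hz hxyz
          simp only [coe_filter, mem_univ, true_and, Set.mem_ofPred_eq] at hx hy hz
          have hxyz' : (x : G) + z = y + y := by exact_mod_cast congrArg Subtype.val hxyz
          have := hS hx hy hz (by rw [add_add_add_comm, hxyz', add_add_add_comm])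
          exact Subtype.ext (add_left_cancel this)
        rw [le_div_iff₀ hq', mul_comm, Nat.card_eq_fintype_card]
        exact (ih hfree (hr.ker χ) (Nat.cast_pos.2 Fintype.card_pos)
          (Nat.cast_le.2 (card_le_univ _))).le
      have hχ₀ : χ ≠ 0 := by
        rintro rfl
        simp at hχ
      have h := χ.card_ker_mul_norm_sum_le S hχ₀ (2 * Nat.card χ.ker / q) hcoset
      refine le_of_mul_le_mul_left (h.trans_eq ?_) hK
      field_simp
    obtain ⟨g, hg⟩ := hr.exists_add_self_ne_zero
    obtain ⟨χ, hχ⟩ := AddChar.exists_apply_ne_zero.2 hg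
    have h := hS.card_sq_le _ ((norm_nonneg _).trans (hbound χ ⟨g, hχ⟩)) hbound
    have hpow : (q : ℝ) * (q + 1) < 2 * Fintype.card G := by
      have h₁ : 2 ^ (q + 1) ≤ Fintype.card G := Nat.card_eq_fintype_card (α := G) ▸ hr.two_pow_le_card
      have h₂ : q * (q + 1) < 2 * 2 ^ (q + 1) := by
        clear * -
        induction q with
        | zero => simp
        | succ q ih =>
          have := Nat.lt_two_pow_self (n := q)
          rw [pow_succ] at ih ⊢
          rw [pow_succ]
          nlinarith
      exact_mod_cast h₂.trans_le (Nat.mul_le_mul_left 2 h₁)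
    set n : ℝ := (Fintype.card G : ℝ)
    set p : ℝ := (#S : ℝ) with hp
    have hp₀ : 0 ≤ p := Nat.cast_nonneg _
    push_cast
    rcases hp₀.eq_or_lt with hp₀ | hp₀
    · rw [← hp₀, mul_zero]
      linarith
    have hkey : p * (q + 2) ≤ 2 * n + q := by
      have hfactor : (n * p) * (p * (q + 2)) ≤ (n * p) * (2 * n + q) := by
        have hdiv : 2 * n / q * q = 2 * n := div_mul_cancel₀ _ hq'.ne'
        have hmul := mul_le_mul_of_nonneg_left h hq'.le
        have hrhs : q * (n * p + (2 * n / q - p) * (n * p - p ^ 2)) =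
            q * n * p + (2 * n - q * p) * (n * p - p ^ 2) := by
          linear_combination (n * p - p ^ 2) * hdiv
        rw [hrhs] at hmul
        nlinarith
      exact le_of_mul_le_mul_left hfactor (mul_pos hn hp₀)
    have hfinal : ((q + 1) * p) * (q + 2) < (2 * n) * (q + 2) := by nlinarith
    exact lt_of_mul_lt_mul_right hfinal (by positivity)


/-- Lev's theorem: if `G` is a finite abelian group with `2G` nontrivial and
`S ⊆ G` has no three-term arithmetic progression, then `|S| < 2|G| / rank(2G)`,
where `rank(2G)` is the minimal number of generators of the subgroup `2G = {2g : g ∈ G}`. -/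
theorem lev {G : Type*} [AddCommGroup G] [Fintype G]
    (H : AddSubgroup G) (hH : (H : Set G) = {g : G | ∃ x : G, g = x + x})
    (hnt : H ≠ ⊥)
    (r : ℕ)
    (hr : IsLeast {m : ℕ | ∃ T : Finset G, T.card = m ∧
            AddSubgroup.closure (T : Set G) = H} r)
    (S : Finset G)
    (hS : ∀ x ∈ S, ∀ y ∈ S, ∀ z ∈ S, x + z = y + y → x = y ∧ y = z) :
    (S.card : ℝ) < 2 * Fintype.card G / r := by
  classical
  have hrank : DoublingRankGE G r := by
    intro T hT
    refine (hr.2 ⟨T.image fun t => t + t, rfl, le_antisymm ?_ ?_⟩).trans Finset.card_image_le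
    · rw [AddSubgroup.closure_le, hH]
      intro x hx
      obtain ⟨t, -, rfl⟩ := Finset.mem_image.1 (Finset.mem_coe.1 hx)
      exact ⟨t, rfl⟩
    · intro x hx
      rw [← SetLike.mem_coe, hH] at hx
      obtain ⟨g, rfl⟩ := hx
      simpa using hT g
  have hpos : 0 < r := by
    rw [Nat.pos_iff_ne_zero]
    rintro rfl
    obtain ⟨T, hT, hcl⟩ := hr.1
    rw [Finset.card_eq_zero] at hT
    exact hnt (by simpa [hT] using hcl.symm)
  have hfree : ThreeAPFree (S : Set G) := fun x hx y hy z hz h => (hS x hx y hy z hz h).1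
  rw [lt_div_iff₀ (Nat.cast_pos.2 hpos), mul_comm]
  exact hfree.mul_card_lt hrank
end
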